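/- Let W be a weakly admissible Wilson loop diagram with at least 5 vertices in which every vertex supports at least one propagator. Then at least one of the following holds: (1) W has a propagator of length at most 6 such that on one side of it there lies exactly one other propagator, and that propagator has length 2; (2) W has two length-2 propagators (i, i+2) and (j, j+2) with j ∈ {i+2, i+3, i+4} such that no other propagator has an end between vertices i+2 and j+1. -/

import Mathlib

open scoped Classical

namespace WLD

/-- A propagator of a Wilson loop diagram on the cyclically ordered vertex set
`ZMod n` (vertex `n` is identified with `0`): an unordered pair of edges, the
edge joining vertex `i` to vertex `i+1` being labelled `i`. -/
abbrev Prp (n : ℕ) := Sym2 (ZMod n)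

variable (n : ℕ)

/-- The position of `x` in the linear order `i <_i i+1 <_i ⋯ <_i i-1`. -/
def ord (i x : ZMod n) : ℕ := (x - i).val

/-- The other end of a propagator `p` having an end on the edge `e`. -/
noncomputable def otherEnd (p : Prp n) (e : ZMod n) : ZMod n :=
  if h : e ∈ p then Sym2.Mem.other h else e

/-- The vertex support `V(p) = {i, i+1, j, j+1}` of the propagator `p = (i,j)`. -/
def supp (p : Prp n) : Finset (ZMod n) :=
  Sym2.lift ⟨fun i j => {i, i + 1, j, j + 1}, fun i j => by
    ext x
    simp only [Finset.mem_insert, Finset.mem_singleton]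
    tauto⟩ p

/-- The vertex support `V(Q)` of a set of propagators. -/
def suppSet (Q : Finset (Prp n)) : Finset (ZMod n) := Q.biUnion (supp n)

/-- `Prop(U)`: the propagators of `P` supported on (a vertex of) `U`. -/
noncomputable def propsOn (P : Finset (Prp n)) (U : Finset (ZMod n)) : Finset (Prp n) :=
  P.filter fun p => (supp n p ∩ U).Nonempty

/-- Two propagators `p = (i,j)` and `q = (k,l)` cross if `i < k < j < l` cyclically. -/
def Crossing (p q : Prp n) : Prop :=
  ∃ i j k l : ZMod n, p = s(i, j) ∧ q = s(k, l) ∧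
    0 < ord n i k ∧ ord n i k < ord n i j ∧ ord n i j < ord n i l

/-- Weak admissibility of a Wilson loop diagram. -/
structure IsWeaklyAdmissible (P : Finset (Prp n)) : Prop where
  dense : ∀ Q ⊆ P, Q.Nonempty → Q.card + 3 ≤ (suppSet n Q).card
  noncross : ∀ p ∈ P, ∀ q ∈ P, ¬ Crossing n p q

/-- Admissibility of a Wilson loop diagram. -/
structure IsAdmissible (P : Finset (Prp n)) : Prop where
  card_add_four_le : P.card + 4 ≤ n
  dense : ∀ Q ⊆ P, Q.Nonempty → Q.card + 3 ≤ (suppSet n Q).card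
  noncross : ∀ p ∈ P, ∀ q ∈ P, ¬ Crossing n p q

/-- The length of a propagator `p = (i,j)`:
`min(|[i+1, j]|, |[j+1, i]|)`, the number of vertices on its smaller side. -/
def plength (p : Prp n) : ℕ :=
  Sym2.lift ⟨fun i j => min ((j - i - 1).val + 1) ((i - j - 1).val + 1),
    fun _ _ => min_comm _ _⟩ p

/-- `InsideDir n i p q` : the propagator `q = (k,l)` lies (weakly) inside the
propagator `p = (i,j)` directed from its end `i`, i.e. `i ≤_i k <_i l ≤_i j`. -/
def InsideDir (i : ZMod n) (p q : Prp n) : Prop :=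
  ∃ j k l : ZMod n, p = s(i, j) ∧ q = s(k, l) ∧
    ord n i k < ord n i l ∧ ord n i l ≤ ord n i j

/-- Sorting key measuring how far clockwise of the vertex `a` the relevant end of
a propagator supported on `a` is attached: ends on the edge `a-1` are clockwise of
ends on the edge `a`, and on a fixed edge an end is the more clockwise the larger
the propagator is (nestedness of noncrossing propagators sharing an edge). -/
noncomputable def cwKey (a : ZMod n) (p : Prp n) : ℕ :=
  if a - 1 ∈ p then n + ord n (a - 1) (otherEnd n p (a - 1))
  else ord n a (otherEnd n p a)

/-- The clockwise-most propagator of `S` supported on the vertex `a`, if any. -/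
noncomputable def pickCW (S : Finset (Prp n)) (a : ZMod n) : Option (Prp n) :=
  if h : (S.filter fun p => a ∈ supp n p).Nonempty then
    some (Classical.choose
      ((S.filter fun p => a ∈ supp n p).exists_max_image (cwKey n a) h))
  else none

/-- The Grassmann necklace algorithm started at the vertex `i`: after `t` steps,
`(gnRun n P i t).1` is the set of propagators not yet deleted, and
`(gnRun n P i t).2` records the vertex assigned to each deleted propagator.
Step `t+1` processes the vertex `i + t`: if some not-yet-deleted propagator is
supported on it, the clockwise-most such propagator is deleted and assigned
that vertex. -/
noncomputable def gnRun (P : Finset (Prp n)) (i : ZMod n) :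
    ℕ → Finset (Prp n) × (Prp n → Option (ZMod n))
  | 0 => (P, fun _ => none)
  | t + 1 =>
    match pickCW n (gnRun P i t).1 (i + (t : ZMod n)) with
    | none => gnRun P i t
    | some p => ((gnRun P i t).1.erase p,
        Function.update (gnRun P i t).2 p (some (i + (t : ZMod n))))

/-- `I_i^W(p)`: the vertex contributed by the propagator `p` to the Grassmann
necklace term `I_i^W` (as an `Option`; the algorithm makes one full circuit of
the vertex set, i.e. runs for `n` steps). -/
noncomputable def gnAssign (P : Finset (Prp n)) (i : ZMod n) (p : Prp n) :
    Option (ZMod n) :=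
  (gnRun n P i n).2 p

/-- The Grassmann necklace term `I_i^W` produced by the algorithm. -/
noncomputable def gnSet [NeZero n] (P : Finset (Prp n)) (i : ZMod n) :
    Finset (ZMod n) :=
  Finset.univ.filter fun v => ∃ p, gnAssign n P i p = some v

/-- The cyclic interval `{a, a+1, …, a + (len-1)}` in `ZMod n`. -/
def cInterval [NeZero n] (a : ZMod n) (len : ℕ) : Finset (ZMod n) :=
  Finset.univ.filter fun x => ord n a x < len

/-- A Grassmann necklace of type `(k, n)`: a cyclic sequence of `k`-element
subsets of the vertex set such that `I_{i+1} = (I_i \ {i}) ∪ {j}` for some `j`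
whenever `i ∈ I_i`, and `I_{i+1} = I_i` otherwise. -/
def IsGrassmannNecklace [NeZero n] (k : ℕ) (I : ZMod n → Finset (ZMod n)) : Prop :=
  (∀ i, (I i).card = k) ∧
  ∀ i : ZMod n,
    (i ∈ I i → ∃ j : ZMod n, I (i + 1) = insert j ((I i).erase i)) ∧
    (i ∉ I i → I (i + 1) = I i)

/-- Independence in the matroid `M(W)`: no subset `U` of `J` supports fewer
propagators than the vertices it contains. -/
def Indep (P : Finset (Prp n)) (J : Finset (ZMod n)) : Prop :=
  ∀ U ⊆ J, U.card ≤ (propsOn n P U).card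

/-- `A` is lexicographically smaller than `B` with respect to the order `<_i`:
the `<_i`-least element of the symmetric difference lies in `A`. -/
def LexLt (i : ZMod n) (A B : Finset (ZMod n)) : Prop :=
  ∃ v, v ∈ A ∧ v ∉ B ∧ ∀ w, ord n i w < ord n i v → (w ∈ A ↔ w ∈ B)

/-- A `+` is placed in the box `(a, b)` of the Le diagram with row labels `I₁`
by the necklace term `Ii`: writing `I₁ \ Ii = {a₁ > ⋯ > a_r}` and
`Ii \ I₁ = {b₁ < ⋯ < b_r}` in the `<₁` order, the plusses are in the boxes
`(a_t, b_t)`. -/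
def LePlusAt (I₁ Ii : Finset (ZMod n)) (a b : ZMod n) : Prop :=
  a ∈ I₁ \ Ii ∧ b ∈ Ii \ I₁ ∧
    ((I₁ \ Ii).filter fun x => ord n 1 a < ord n 1 x).card =
      ((Ii \ I₁).filter fun y => ord n 1 y < ord n 1 b).card

/-- The box `(a, b)` of the Le diagram of the diagram `P` contains a `+`. -/
def LePlus [NeZero n] (P : Finset (Prp n)) (a b : ZMod n) : Prop :=
  ∃ i : ZMod n, LePlusAt n (gnSet n P 1) (gnSet n P i) a b

/-- The number of `+` entries in the Le diagram of the diagram `P`. -/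
noncomputable def plusCount [NeZero n] (P : Finset (Prp n)) : ℕ :=
  (Finset.univ.filter fun ab : ZMod n × ZMod n => LePlus n P ab.1 ab.2).card

/-- The length of the row labelled `a` of the Young diagram with row labels `I₁`
(the boxes of row `a` are indexed by the column labels `b ∉ I₁` with `a <₁ b`). -/
noncomputable def rowLen [NeZero n] (I₁ : Finset (ZMod n)) (a : ZMod n) : ℕ :=
  (Finset.univ.filter fun b => b ∉ I₁ ∧ ord n 1 a < ord n 1 b).card

/-- The entry of the matrix `C(W)` in row `p` and column `q`: the indeterminate
`x_{p,q}` if `q ∈ V(p)`, and `0` otherwise. -/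
noncomputable def CW (p : Prp n) (q : ZMod n) : MvPolynomial (Prp n × ZMod n) ℝ :=
  if q ∈ supp n p then MvPolynomial.X (p, q) else 0

/-- The column paired with the row `p` in the minors determined by `I_i^W`. -/
noncomputable def colOf (P : Finset (Prp n)) (i : ZMod n) (p : Prp n) : ZMod n :=
  (gnAssign n P i p).getD i

/-- `Δ_{I_i}`: the determinant of the `k × k` minor of `C(W)` on the columns
indexed by `I_i^W`, rows and columns paired via the necklace assignment. -/
noncomputable def Delta (P : Finset (Prp n)) (i : ZMod n) :
    MvPolynomial (Prp n × ZMod n) ℝ :=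
  Matrix.det (Matrix.of fun p q : ↥P => CW n (p : Prp n) (colOf n P i (q : Prp n)))

/-- `S_i`: the propagators whose contribution changes from `I_{i-1}` to `I_i`. -/
noncomputable def Schanged (P : Finset (Prp n)) (i : ZMod n) : Finset (Prp n) :=
  P.filter fun p => gnAssign n P (i - 1) p ≠ gnAssign n P i p

/-- `r_i`: the determinant of the minor of `C(W)` with rows indexed by `S_i` and
columns indexed by `I_i(S_i)` (equal to `1` when `S_i = ∅`). -/
noncomputable def rfac (P : Finset (Prp n)) (i : ZMod n) :
    MvPolynomial (Prp n × ZMod n) ℝ :=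
  Matrix.det
    (Matrix.of fun p q : ↥(Schanged n P i) => CW n (p : Prp n) (colOf n P i (q : Prp n)))

/-- `R = ∏ᵢ rᵢ`, the polynomial produced by the algorithm. -/
noncomputable def Rpoly [NeZero n] (P : Finset (Prp n)) :
    MvPolynomial (Prp n × ZMod n) ℝ :=
  ∏ i : ZMod n, rfac n P i

/-- Position of the end of the propagator `p` along the edge `e`: larger values
attach closer to the vertex `e`, i.e. earlier in the counterclockwise ordering
of the ends of propagators along the edge `e`. -/
noncomputable def edgeKey (e : ZMod n) (p : Prp n) : ℕ := ord n e (otherEnd n p e)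

/-- The propagators of `P` with an end on the edge `e`. -/
noncomputable def onEdge (P : Finset (Prp n)) (e : ZMod n) : Finset (Prp n) :=
  P.filter fun p => e ∈ p

/-- `p` is the first propagator (`p₁`) on the edge `e` in the counterclockwise
ordering of the propagators with an end on the edge `e`. -/
def IsCcwFirst (P : Finset (Prp n)) (e : ZMod n) (p : Prp n) : Prop :=
  p ∈ onEdge n P e ∧ ∀ q ∈ onEdge n P e, edgeKey n e q ≤ edgeKey n e p

/-- `p` is the last propagator (`p_r`) on the edge `e` in the counterclockwise
ordering of the propagators with an end on the edge `e`. -/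
def IsCcwLast (P : Finset (Prp n)) (e : ZMod n) (p : Prp n) : Prop :=
  p ∈ onEdge n P e ∧ ∀ q ∈ onEdge n P e, edgeKey n e p ≤ edgeKey n e q

/-- `p` and `q` are consecutive, in this order (`p = p_j`, `q = p_{j+1}`), in the
counterclockwise ordering of the propagators with an end on the edge `e`. -/
def ConsecOnEdge (P : Finset (Prp n)) (e : ZMod n) (p q : Prp n) : Prop :=
  p ∈ onEdge n P e ∧ q ∈ onEdge n P e ∧ edgeKey n e q < edgeKey n e p ∧
    ∀ r ∈ onEdge n P e, ¬ (edgeKey n e q < edgeKey n e r ∧ edgeKey n e r < edgeKey n e p)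

/-- The factor `R_e` of the denominator `R(W)` associated to the edge `e`:
`R_e = x_{p₁,e+1} • ∏_{j=1}^{r-1} (x_{p_j,e} x_{p_{j+1},e+1} - x_{p_{j+1},e} x_{p_j,e+1}) • x_{p_r,e}`
for the counterclockwise ordering `p₁, …, p_r` of the propagators on the edge `e`
(`R_e = 1` if there are none). -/
noncomputable def Redge (P : Finset (Prp n)) (e : ZMod n) :
    MvPolynomial (Prp n × ZMod n) ℝ :=
  (∏ p ∈ (onEdge n P e).filter (IsCcwFirst n P e), MvPolynomial.X (p, e + 1)) *
    (∏ pq ∈ (P ×ˢ P).filter (fun pq => ConsecOnEdge n P e pq.1 pq.2),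
      (MvPolynomial.X (pq.1, e) * MvPolynomial.X (pq.2, e + 1) -
        MvPolynomial.X (pq.2, e) * MvPolynomial.X (pq.1, e + 1))) *
    (∏ p ∈ (onEdge n P e).filter (IsCcwLast n P e), MvPolynomial.X (p, e))

/-- The denominator `R(W) = ∏ₑ R_e` of the integrand `Ω(W)`. -/
noncomputable def RW [NeZero n] (P : Finset (Prp n)) :
    MvPolynomial (Prp n × ZMod n) ℝ :=
  ∏ e : ZMod n, Redge n P e

/-- The relabelling map associated to the removal of the vertex `i` from the
vertex set `ZMod n`: the vertex of `ZMod (n-1)` in position `t` (in the `<₁`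
order) is sent to the vertex of `ZMod n` in position `t` if `t` precedes the
position of `i`, and to the vertex in position `t+1` otherwise. -/
noncomputable def liftVert (i : ZMod n) (x : ZMod (n - 1)) : ZMod n :=
  1 + ((if ord (n - 1) 1 x < ord n 1 i then ord (n - 1) 1 x
        else ord (n - 1) 1 x + 1 : ℕ) : ZMod n)

end WLD
namespace WLD

section
variable {n : ℕ}

/-- In the coordinates `x ↦ i + x` on the edges, `P` contains the propagator with ends at
positions `x < y < n`. -/
def Arc (P : Finset (Prp n)) (i : ZMod n) (x y : ℕ) : Prop :=
  x < y ∧ y < n ∧ (s(i + (x : ZMod n), i + (y : ZMod n)) : Prp n) ∈ P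

/-- The arc at positions `0`, `m` has another propagator on its side `[i, i + m]`. -/
def HasInner (P : Finset (Prp n)) (i : ZMod n) (m : ℕ) : Prop :=
  ∃ x y, Arc P i x y ∧ y ≤ m ∧ ¬ (x = 0 ∧ y = m)

variable {P : Finset (Prp n)} {i : ZMod n} {x y z w m : ℕ}

lemma ord_add_natCast (i : ZMod n) (hxz : x ≤ z) (hz : z < n) :
    ord n (i + x) (i + z) = z - x := by
  have h : i + (z : ZMod n) - (i + x) = ((z - x : ℕ) : ZMod n) := by
    rw [Nat.cast_sub hxz]; ring
  rw [ord, h, ZMod.val_natCast_of_lt (by omega)]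

lemma ord_self_add_natCast (i : ZMod n) (hz : z < n) : ord n i (i + z) = z := by
  simpa using ord_add_natCast (x := 0) i (Nat.zero_le z) hz

lemma IsWeaklyAdmissible.ends_not_adjacent (h : IsWeaklyAdmissible n P) {a b : ZMod n}
    (hp : (s(a, b) : Prp n) ∈ P) : b ≠ a ∧ b ≠ a + 1 := by
  have hd := h.dense {s(a, b)} (by simpa using hp) (by simp)
  have hs : suppSet n {s(a, b)} = {a, a + 1, b, b + 1} := by
    simp [suppSet, supp]
  rw [hs, Finset.card_singleton] at hd
  have key : ∀ c d e : ZMod n, ({a, a + 1, b, b + 1} : Finset (ZMod n)) ⊆ {c, d, e} → False := by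
    intro c d e hsub
    have := Finset.card_le_card hsub
    have := Finset.card_le_three (a := c) (b := d) (c := e)
    omega
  refine ⟨fun hb => ?_, fun hb => ?_⟩
  · refine key a a (a + 1) fun v => ?_
    simp only [hb, Finset.mem_insert, Finset.mem_singleton]; tauto
  · refine key a b (b + 1) fun v => ?_
    simp only [← hb, Finset.mem_insert, Finset.mem_singleton]; tauto

lemma plength_mk_add (i : ZMod n) (hx : x < y) (hy : y < n) :
    plength n s(i + (x : ZMod n), i + (y : ZMod n)) = min (y - x) (n - (y - x)) := by
  have h1 : i + (y : ZMod n) - (i + x) - 1 = ((y - x - 1 : ℕ) : ZMod n) := by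
    rw [Nat.cast_sub (by omega), Nat.cast_sub (by omega)]; push_cast; ring
  have h2 : i + (x : ZMod n) - (i + y) - 1 = ((n - (y - x) - 1 : ℕ) : ZMod n) := by
    rw [Nat.cast_sub (by omega), Nat.cast_sub (by omega), Nat.cast_sub (by omega)]
    simp
  rw [plength, Sym2.lift_mk]
  dsimp only
  rw [h1, h2, ZMod.val_natCast_of_lt (by omega), ZMod.val_natCast_of_lt (by omega)]
  congr 1 <;> omega

lemma natCast_add_inj (hx : x < n) (hy : y < n)
    (h : i + (x : ZMod n) = i + (y : ZMod n)) : x = y := by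
  rw [← ord_self_add_natCast i hx, h, ord_self_add_natCast i hy]

lemma Arc.gap (h : IsWeaklyAdmissible n P) (ha : Arc P i x y) : x + 2 ≤ y := by
  obtain ⟨hxy, -, hp⟩ := ha
  by_contra hlt
  obtain rfl : y = x + 1 := by omega
  exact (h.ends_not_adjacent hp).2 (by push_cast; ring)

lemma Arc.not_interleave (h : IsWeaklyAdmissible n P) (ha : Arc P i x y)
    (hb : Arc P i z w) : ¬ (x < z ∧ z < y ∧ y < w) := by
  rintro ⟨h1, h2, h3⟩
  refine h.noncross _ ha.2.2 _ hb.2.2 ⟨_, _, _, _, rfl, rfl, ?_⟩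
  have := ha.2.1
  have := hb.2.1
  rw [ord_add_natCast i (by omega) (by omega), ord_add_natCast i (by omega) (by omega),
    ord_add_natCast i (by omega) (by omega)]
  omega

lemma Arc.eq_of_mk_eq (ha : Arc P i x y) (hb : Arc P i z w)
    (h : (s(i + (x : ZMod n), i + (y : ZMod n)) : Prp n) = s(i + (z : ZMod n), i + (w : ZMod n))) :
    x = z ∧ y = w := by
  obtain ⟨hxy, hy, -⟩ := ha
  obtain ⟨hzw, hw, -⟩ := hb
  rcases Sym2.eq_iff.1 h with ⟨h1, h2⟩ | ⟨h1, h2⟩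
  · exact ⟨natCast_add_inj (by omega) (by omega) h1, natCast_add_inj hy hw h2⟩
  · have := natCast_add_inj (by omega) (by omega) h1
    have := natCast_add_inj (by omega) (by omega) h2
    omega

lemma Arc.shift (ha : Arc P i x y) : Arc P (i + x) 0 (y - x) := by
  obtain ⟨hxy, hy, hp⟩ := ha
  refine ⟨by omega, by omega, ?_⟩
  have h : i + (x : ZMod n) + ((y - x : ℕ) : ZMod n) = i + y := by
    rw [Nat.cast_sub hxy.le]; ring
  simpa [h] using hp

lemma Arc.flip (ha : Arc P i 0 m) : Arc P (i + m) 0 (n - m) := by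
  obtain ⟨hm, hmn, hp⟩ := ha
  refine ⟨by omega, by omega, ?_⟩
  have h : i + (m : ZMod n) + ((n - m : ℕ) : ZMod n) = i := by
    rw [Nat.cast_sub hmn.le]; simp
  rw [h, Sym2.eq_swap]
  simpa using hp

lemma insideDir_iff (ha : Arc P i 0 m) (hb : Arc P i x y) :
    InsideDir n i s(i, i + (m : ZMod n)) s(i + (x : ZMod n), i + (y : ZMod n)) ↔ y ≤ m := by
  have hxy := hb.1
  have hy := hb.2.1
  constructor
  · rintro ⟨j, k, l, hj, hkl, h1, h2⟩
    obtain rfl := Sym2.congr_right.1 hj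
    rw [ord_self_add_natCast i ha.2.1] at h2
    rcases Sym2.eq_iff.1 hkl with ⟨rfl, rfl⟩ | ⟨rfl, rfl⟩
    · rwa [ord_self_add_natCast i hy] at h2
    · rw [ord_self_add_natCast i hy, ord_self_add_natCast i (by omega)] at h1
      omega
  · intro hym
    refine ⟨_, _, _, rfl, rfl, ?_⟩
    rw [ord_self_add_natCast i hy, ord_self_add_natCast i (by omega),
      ord_self_add_natCast i ha.2.1]
    exact ⟨hxy, hym⟩

/-- A propagator with an end strictly inside one side of an arc lies on that side. -/
lemma Arc.inner_of_end (h : IsWeaklyAdmissible n P) (ha : Arc P i 0 m)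
    (hb : Arc P i x y) (he : (0 < x ∧ x < m) ∨ (0 < y ∧ y < m)) :
    y ≤ m ∧ ¬ (x = 0 ∧ y = m) := by
  have := ha.not_interleave h hb
  have := hb.1
  omega

variable [NeZero n]

lemma ord_lt (i e : ZMod n) : ord n i e < n := ZMod.val_lt _

lemma add_ord (i e : ZMod n) : i + (ord n i e : ZMod n) = e := by
  simp [ord]

lemma exists_arc_of_mem (h : IsWeaklyAdmissible n P) (i : ZMod n) {r : Prp n} (hr : r ∈ P) :
    ∃ x y, Arc P i x y ∧ r = s(i + (x : ZMod n), i + (y : ZMod n)) := by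
  induction r using Sym2.ind with
  | _ a b =>
    have hne := (h.ends_not_adjacent hr).1
    rcases lt_trichotomy (ord n i a) (ord n i b) with hlt | heq | hlt
    · exact ⟨_, _, ⟨hlt, ord_lt i b, by simpa only [add_ord] using hr⟩, by simp only [add_ord]⟩
    · exact absurd (by rw [← add_ord i b, ← heq, add_ord]) hne
    · rw [Sym2.eq_swap] at hr ⊢
      exact ⟨_, _, ⟨hlt, ord_lt i a, by simpa only [add_ord] using hr⟩, by simp only [add_ord]⟩

/-- Of two consecutive edges strictly inside one side of an arc, one has an end of a
propagator lying on that side. -/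
lemma Arc.exists_inner_end (h : IsWeaklyAdmissible n P)
    (hcover : ∀ v : ZMod n, ∃ p ∈ P, v ∈ supp n p)
    (ha : Arc P i 0 m) {e : ℕ} (he : 0 < e) (hem : e + 1 < m) :
    ∃ x y, Arc P i x y ∧ y ≤ m ∧ ¬ (x = 0 ∧ y = m) ∧
      (x = e ∨ y = e ∨ x = e + 1 ∨ y = e + 1) := by
  obtain ⟨p, hp, hv⟩ := hcover (i + ((e + 1 : ℕ) : ZMod n))
  obtain ⟨x, y, hb, rfl⟩ := exists_arc_of_mem h i hp
  have hm := ha.2.1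
  have hxy := hb.1
  have hy := hb.2.1
  have hsucc : ∀ t : ℕ, t < n → i + ((e + 1 : ℕ) : ZMod n) = i + (t : ZMod n) + 1 → t = e := by
    intro t ht heq
    refine natCast_add_inj (i := i) ht (by omega) ?_
    push_cast at heq
    linear_combination -heq
  have hend : x = e ∨ y = e ∨ x = e + 1 ∨ y = e + 1 := by
    simp only [supp, Sym2.lift_mk, Finset.mem_insert, Finset.mem_singleton] at hv
    rcases hv with hv | hv | hv | hv
    · exact .inr (.inr (.inl (natCast_add_inj (by omega) (by omega) hv.symm)))
    · exact .inl (hsucc x (by omega) hv)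
    · exact .inr (.inr (.inr (natCast_add_inj (by omega) (by omega) hv.symm)))
    · exact .inr (.inl (hsucc y hy hv))
  obtain ⟨h1, h2⟩ := ha.inner_of_end h hb (by omega)
  exact ⟨x, y, hb, h1, h2, hend⟩

lemma Arc.eq_two_of_not_hasInner (h : IsWeaklyAdmissible n P)
    (hcover : ∀ v : ZMod n, ∃ p ∈ P, v ∈ supp n p)
    (ha : Arc P i 0 m) (hi : ¬ HasInner P i m) : m = 2 := by
  have := ha.gap h
  by_contra hne
  obtain ⟨x, y, hb, h1, h2, -⟩ :=
    ha.exists_inner_end h hcover (e := 1) (by omega) (by omega)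
  exact hi ⟨x, y, hb, h1, h2⟩

lemma exists_arc_hasInner (h : IsWeaklyAdmissible n P)
    (hcover : ∀ v : ZMod n, ∃ p ∈ P, v ∈ supp n p) (hn : 5 ≤ n) :
    ∃ m, ∃ i, Arc P i 0 m ∧ HasInner P i m := by
  obtain ⟨p, hp, -⟩ := hcover 0
  obtain ⟨x, y, hb, -⟩ := exists_arc_of_mem h 0 hp
  by_contra! hno
  have h1 := hb.shift.eq_two_of_not_hasInner h hcover (hno _ _ hb.shift)
  have h2 := hb.shift.flip.eq_two_of_not_hasInner h hcover (hno _ _ hb.shift.flip)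
  omega

/-- There is an arc with an inner propagator all of whose inner propagators have length two. -/
lemma exists_arc_inner_eq_add_two (h : IsWeaklyAdmissible n P)
    (hcover : ∀ v : ZMod n, ∃ p ∈ P, v ∈ supp n p) (hn : 5 ≤ n) :
    ∃ m i, Arc P i 0 m ∧ HasInner P i m ∧
      ∀ x y, Arc P i x y → y ≤ m → ¬ (x = 0 ∧ y = m) → y = x + 2 := by
  have hex := exists_arc_hasInner h hcover hn
  obtain ⟨i, ha, hin⟩ := Nat.find_spec hex
  refine ⟨_, i, ha, hin, fun x y hb hy hne => ?_⟩
  have hxy := hb.1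
  have := hb.shift.eq_two_of_not_hasInner h hcover
    fun hc => Nat.find_min hex (m := y - x) (by omega) ⟨_, hb.shift, hc⟩
  omega

end

/-- Lemma on forced propagator configurations.
Let `W` be a weakly admissible Wilson loop diagram with at least 5 vertices in
which every vertex supports at least one propagator.  Then at least one of the
following holds: (1) `W` has a propagator of length at most 6 such that on one
side of it there lies exactly one other propagator, and that propagator has
length 2; (2) `W` has two length-2 propagators `(i, i+2)` and `(j, j+2)` with
`j ∈ {i+2, i+3, i+4}` such that no other propagator has an end between the
vertices `i+2` and `j+1`. -/
theorem exists_small_configuration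
    (n : ℕ) [NeZero n] (P : Finset (Prp n)) (hwadm : IsWeaklyAdmissible n P)
    (hn : 5 ≤ n) (hcover : ∀ v : ZMod n, ∃ p ∈ P, v ∈ supp n p) :
    (∃ p ∈ P, plength n p ≤ 6 ∧ ∃ i j : ZMod n, p = s(i, j) ∧
      ∃ q ∈ P, q ≠ p ∧ plength n q = 2 ∧ InsideDir n i p q ∧
        ∀ r ∈ P, InsideDir n i p r → r = p ∨ r = q) ∨
    (∃ i j : ZMod n, (s(i, i + 2) : Prp n) ∈ P ∧ (s(j, j + 2) : Prp n) ∈ P ∧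
      (j = i + 2 ∨ j = i + 3 ∨ j = i + 4) ∧
      ∀ r ∈ P, r ≠ (s(i, i + 2) : Prp n) → r ≠ (s(j, j + 2) : Prp n) →
        ∀ e : ZMod n, e ∈ r → ¬ ord n (i + 2) e ≤ ord n (i + 2) j) := by
  obtain ⟨m, i, ha, ⟨x₀, y₀, hb₀, hy₀, hne₀⟩, hear⟩ :=
    exists_arc_inner_eq_add_two hwadm hcover hn
  have hm := ha.2.1
  have hex : ∃ c, Arc P i c (c + 2) ∧ c + 2 ≤ m ∧ ¬ (c = 0 ∧ c + 2 = m) := by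
    obtain rfl := hear _ _ hb₀ hy₀ hne₀
    exact ⟨x₀, hb₀, hy₀, hne₀⟩
  obtain ⟨c, ⟨hc, hcm, hc0⟩, hcmin⟩ :
      ∃ c, (Arc P i c (c + 2) ∧ c + 2 ≤ m ∧ ¬ (c = 0 ∧ c + 2 = m)) ∧
        ∀ d, (Arc P i d (d + 2) ∧ d + 2 ≤ m ∧ ¬ (d = 0 ∧ d + 2 = m)) → c ≤ d :=
    ⟨Nat.find hex, Nat.find_spec hex, fun d hd => Nat.find_min' hex hd⟩
  have hsep : ∀ d, Arc P i d (d + 2) → c < d → c + 2 ≤ d := fun d hd hlt => by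
    have := hc.not_interleave hwadm hd
    omega
  by_cases hex2 : ∃ d, Arc P i d (d + 2) ∧ d + 2 ≤ m ∧ c < d
  · right
    obtain ⟨d, ⟨hd, hdm, hcd⟩, hdmin⟩ :
        ∃ d, (Arc P i d (d + 2) ∧ d + 2 ≤ m ∧ c < d) ∧
          ∀ e, (Arc P i e (e + 2) ∧ e + 2 ≤ m ∧ c < e) → d ≤ e :=
      ⟨Nat.find hex2, Nat.find_spec hex2, fun d hd => Nat.find_min' hex2 hd⟩
    have hcd2 := hsep d hd hcd
    have hclass : ∀ x y, Arc P i x y → y ≤ m → ¬ (x = 0 ∧ y = m) →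
        y = x + 2 ∧ (x = c ∨ x = d ∨ d < x) := by
      intro x y hb hy hne
      obtain rfl := hear x y hb hy hne
      have := hcmin x ⟨hb, hy, hne⟩
      have := fun hcx => hdmin x ⟨hb, hy, hcx⟩
      omega
    have hgap : d ≤ c + 4 := by
      by_contra hlt
      obtain ⟨x, y, hb, hy, hne, hend⟩ :=
        ha.exists_inner_end hwadm hcover (e := c + 3) (by omega) (by omega)
      have := hclass x y hb hy hne
      omega
    have hcast : ∀ t : ℕ, i + (t : ZMod n) + 2 = i + ((t + 2 : ℕ) : ZMod n) := fun t => by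
      push_cast; ring
    refine ⟨i + c, i + d, ?_, ?_, ?_, ?_⟩
    · rw [hcast]; exact hc.2.2
    · rw [hcast]; exact hd.2.2
    · obtain rfl | rfl | rfl : d = c + 2 ∨ d = c + 3 ∨ d = c + 4 := by omega
      · left; push_cast; ring
      · right; left; push_cast; ring
      · right; right; push_cast; ring
    · intro r hr hrc hrd e her hle
      rw [hcast] at hrc hrd hle
      obtain ⟨x, y, hb, rfl⟩ := exists_arc_of_mem hwadm i hr
      rw [ord_add_natCast i hcd2 (by omega)] at hle
      have he : e = i + ((c + 2 + ord n (i + ((c + 2 : ℕ) : ZMod n)) e : ℕ) : ZMod n) := by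
        rw [Nat.cast_add, ← add_assoc, add_ord]
      generalize ord n (i + ((c + 2 : ℕ) : ZMod n)) e = t at he hle
      have hxy := hb.1
      have hyn := hb.2.1
      have hend : x = c + 2 + t ∨ y = c + 2 + t := by
        rw [he, Sym2.mem_iff] at her
        exact her.imp (fun h => (natCast_add_inj (by omega) (by omega) h).symm)
          (fun h => (natCast_add_inj (by omega) (by omega) h).symm)
      obtain ⟨h1, h2⟩ := ha.inner_of_end hwadm hb (by omega)
      obtain ⟨rfl, rfl | rfl | h3⟩ := hclass x y hb h1 h2
      · exact hrc rfl
      · exact hrd rfl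
      · omega
  · left
    have huniq : ∀ x y, Arc P i x y → y ≤ m → ¬ (x = 0 ∧ y = m) → x = c ∧ y = c + 2 := by
      intro x y hb hy hne
      obtain rfl := hear x y hb hy hne
      have := hcmin x ⟨hb, hy, hne⟩
      have : ¬ c < x := fun hcx => hex2 ⟨x, hb, hy, hcx⟩
      omega
    have hlow : c ≤ 2 := by
      by_contra hlt
      obtain ⟨x, y, hb, hy, hne, hend⟩ :=
        ha.exists_inner_end hwadm hcover (e := 1) (by omega) (by omega)
      have := huniq x y hb hy hne
      omega
    have hhigh : m ≤ c + 4 := by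
      by_contra hlt
      obtain ⟨x, y, hb, hy, hne, hend⟩ :=
        ha.exists_inner_end hwadm hcover (e := c + 3) (by omega) (by omega)
      have := huniq x y hb hy hne
      omega
    have hmk : (s(i, i + (m : ZMod n)) : Prp n) = s(i + ((0 : ℕ) : ZMod n), i + (m : ZMod n)) := by
      simp
    refine ⟨s(i, i + (m : ZMod n)), hmk ▸ ha.2.2, ?_, i, _, rfl, _, hc.2.2, ?_, ?_,
      (insideDir_iff ha hc).2 hcm, ?_⟩
    · rw [hmk, plength_mk_add i ha.1 hm]
      omega
    · intro heq
      have := hc.eq_of_mk_eq ha (heq.trans hmk)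
      omega
    · rw [plength_mk_add i hc.1 hc.2.1]
      omega
    · intro r hr hins
      obtain ⟨x, y, hb, rfl⟩ := exists_arc_of_mem hwadm i hr
      have hy := (insideDir_iff ha hb).1 hins
      by_cases hne : x = 0 ∧ y = m
      · left
        rw [hmk, hne.1, hne.2]
      · right
        obtain ⟨rfl, rfl⟩ := huniq x y hb hy hne
        rfl

end WLD
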